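/- Let 1 < p < 2. Suppose X is a (real or complex) Banach space containing a complemented copy of ℓ_p, witnessed by operators P ∈ L(X, ℓ_p) and Q ∈ L(ℓ_p, X) with P∘Q = id. Suppose Y is a Banach space containing a copy of c₀, and let J : c₀ → Y be any isomorphic embedding. Then there exists an operator U ∈ L(ℓ_p, c₀) which is both finitely strictly singular and superstrictly cosingular, such that J∘U∘P does not belong to the closed linear span in L(X,Y) of the set of operators from X to Y that factor through the Hilbert space ℓ₂. -/

import Mathlib

open scoped ENNReal

noncomputable section

def FinStrictSing {𝕜 X Y : Type*} [NontriviallyNormedField 𝕜]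
    [NormedAddCommGroup X] [NormedSpace 𝕜 X] [NormedAddCommGroup Y] [NormedSpace 𝕜 Y]
    (T : X →L[𝕜] Y) : Prop :=
  ∀ ε : ℝ, 0 < ε → ∃ n : ℕ, ∀ E : Submodule 𝕜 X, Module.finrank 𝕜 E = n →
    ∃ x ∈ E, x ≠ 0 ∧ ‖T x‖ < ε * ‖x‖

def SupStrictCosing {𝕜 X Y : Type*} [NontriviallyNormedField 𝕜]
    [NormedAddCommGroup X] [NormedSpace 𝕜 X] [NormedAddCommGroup Y] [NormedSpace 𝕜 Y]
    (T : X →L[𝕜] Y) : Prop :=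
  ∀ ε : ℝ, 0 < ε → ∃ N : ℕ, ∀ n : ℕ, N ≤ n → ∀ E : Submodule 𝕜 Y,
    IsClosed (E : Set Y) → Module.finrank 𝕜 (Y ⧸ E) = n →
    ∃ x : X, ‖x‖ = 1 ∧ Metric.infDist (T x) (E : Set Y) < ε

/-- The closed linear span of the operators `X → Y` factoring through the Hilbert
space `ℓ₂`. -/
def closedSpanHilbertFactorable (𝕜 X Y : Type*) [RCLike 𝕜]
    [NormedAddCommGroup X] [NormedSpace 𝕜 X] [NormedAddCommGroup Y] [NormedSpace 𝕜 Y] :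
    Submodule 𝕜 (X →L[𝕜] Y) :=
  (Submodule.span 𝕜 {T : X →L[𝕜] Y | ∃ (A : X →L[𝕜] lp (fun _ : ℕ => 𝕜) 2)
      (B : lp (fun _ : ℕ => 𝕜) 2 →L[𝕜] Y), T = B.comp A}).topologicalClosure


open Finset in
/-- Walsh matrix entries. -/
def walsh (k : ℕ) (a b : Fin k → Bool) : ℝ := ∏ l, (if (a l && b l) = true then (-1 : ℝ) else 1)

lemma walsh_sq (k : ℕ) (a b : Fin k → Bool) : walsh k a b * walsh k a b = 1 := by
  unfold walsh
  rw [← Finset.prod_mul_distrib]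
  apply Finset.prod_eq_one
  intro i _
  split_ifs <;> norm_num

lemma walsh_abs (k : ℕ) (a b : Fin k → Bool) : |walsh k a b| = 1 := by
  have h := walsh_sq k a b
  have h2 : |walsh k a b| * |walsh k a b| = 1 := by rw [← abs_mul, h, abs_one]
  nlinarith [abs_nonneg (walsh k a b)]

lemma walsh_orth (k : ℕ) (b b' : Fin k → Bool) :
    ∑ a, walsh k a b * walsh k a b' = if b = b' then (2 : ℝ) ^ k else 0 := by
  split_ifs with h
  · subst h
    simp [walsh_sq]
  · obtain ⟨i, hi⟩ := Function.ne_iff.mp h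
    unfold walsh
    simp_rw [← Finset.prod_mul_distrib]
    have := Finset.sum_prod_piFinset (ι := Fin k) (Finset.univ : Finset Bool)
      (fun l s => (if (s && b l) = true then (-1 : ℝ) else 1) *
        (if (s && b' l) = true then (-1 : ℝ) else 1))
    rw [Fintype.piFinset_univ] at this
    rw [this]
    apply Finset.prod_eq_zero (Finset.mem_univ i)
    rw [Fintype.sum_bool]
    cases hb : b i <;> cases hb' : b' i <;> simp_all

section
variable {𝕜 : Type*} [RCLike 𝕜]

lemma walsh_norm (k : ℕ) (a b : Fin k → Bool) : ‖((walsh k a b : ℝ) : 𝕜)‖ = 1 := by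
  rw [RCLike.norm_ofReal, walsh_abs]

lemma walsh_parseval {H : Type*} [NormedAddCommGroup H] [InnerProductSpace 𝕜 H] (k : ℕ)
    (v : (Fin k → Bool) → H) :
    ∑ a, ‖∑ b, ((walsh k a b : ℝ) : 𝕜) • v b‖ ^ 2 = 2 ^ k * ∑ b, ‖v b‖ ^ 2 := by
  have key : ((∑ a, ‖∑ b, ((walsh k a b : ℝ) : 𝕜) • v b‖ ^ 2 : ℝ) : 𝕜)
      = ((2 ^ k * ∑ b, ‖v b‖ ^ 2 : ℝ) : 𝕜) := by
    push_cast
    simp_rw [← inner_self_eq_norm_sq_to_K (𝕜 := 𝕜)]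
    simp_rw [sum_inner, inner_sum, inner_smul_left, inner_smul_right, RCLike.conj_ofReal]
    rw [Finset.sum_comm, Finset.mul_sum]
    apply Finset.sum_congr rfl
    intro b _
    rw [Finset.sum_comm]
    rw [Finset.sum_eq_single b]
    · simp_rw [← mul_assoc]
      rw [← Finset.sum_mul]
      congr 1
      have := walsh_orth k b b
      rw [if_pos rfl] at this
      rw [← RCLike.ofReal_ofNat, ← RCLike.ofReal_pow, ← this]
      push_cast
      rfl
    · intro b' _ hb'
      simp_rw [← mul_assoc]
      rw [← Finset.sum_mul]
      have := walsh_orth k b b'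
      rw [if_neg (Ne.symm hb')] at this
      have h2 : (∑ a, ((walsh k a b : ℝ) : 𝕜) * ((walsh k a b' : ℝ) : 𝕜)) = 0 := by
        rw [← RCLike.ofReal_zero, ← this]
        push_cast
        rfl
      rw [h2, zero_mul]
    · simp
  exact_mod_cast key

lemma c0_apply_le (z : ZeroAtInftyContinuousMap ℕ 𝕜) (t : ℕ) : ‖z t‖ ≤ ‖z‖ :=
  (BoundedContinuousFunction.norm_coe_le_norm z.toBCF t)

lemma c0_norm_le (z : ZeroAtInftyContinuousMap ℕ 𝕜) {C : ℝ} (hC : 0 ≤ C)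
    (h : ∀ t, ‖z t‖ ≤ C) : ‖z‖ ≤ C :=
  (BoundedContinuousFunction.norm_le (f := z.toBCF) hC).2 h

lemma fss_of_count {X : Type*} [NormedAddCommGroup X] [NormedSpace 𝕜 X]
    (U : X →L[𝕜] ZeroAtInftyContinuousMap ℕ 𝕜)
    (hU : ∀ R η : ℝ, 0 < R → 0 < η → ∃ M : ℕ, ∀ x, ‖x‖ ≤ R →
      ∀ A : Finset ℕ, (∀ t ∈ A, η ≤ ‖U x t‖) → A.card ≤ M) : FinStrictSing U := by
  classical
  intro ε hε
  obtain ⟨M₀, hM₀⟩ := hU (2 / ε) (1 / 4) (by positivity) (by norm_num)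
  set k := M₀ + 1 with hk
  have hkpos : (0 : ℝ) < k := by rw [hk]; positivity
  set η : ℝ := 1 / (4 * k) with hη
  have hηpos : 0 < η := by positivity
  have hkη : k * η = 1 / 4 := by rw [hη]; field_simp
  have hη1 : η ≤ 1 / 4 := by
    rw [← hkη]
    have : (1 : ℝ) ≤ k := by rw [hk]; push_cast; linarith [Nat.cast_nonneg (α := ℝ) M₀]
    nlinarith
  obtain ⟨M, hM⟩ := hU (1 / ε) η (by positivity) hηpos
  refine ⟨k * M + 1, fun E hE => ?_⟩
  by_contra hcon
  push Not at hcon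
  have hlow : ∀ x ∈ E, ε * ‖x‖ ≤ ‖U x‖ := by
    intro x hx
    by_cases h0 : x = 0
    · simp [h0]
    · exact hcon x hx h0
  have : FiniteDimensional 𝕜 E := Module.finite_of_finrank_pos (by omega)
  have claim : ∀ j : ℕ, j ≤ k → ∃ y ∈ E, ∃ S T : Finset ℕ, S.card ≤ j * M ∧ T.card = j ∧ T ⊆ S ∧
      (∀ t, t ∉ S → ‖U y t‖ ≤ j * η) ∧ (∀ t, ‖U y t‖ ≤ 1 + j * η) ∧
      (∀ t ∈ T, 1 / 2 - j * η ≤ ‖U y t‖) := by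
    intro j
    induction j with
    | zero =>
      intro _
      exact ⟨0, E.zero_mem, ∅, ∅, by simp, by simp, by simp, by simp, by simp, by simp⟩
    | succ j ih =>
      intro hj
      obtain ⟨y, hyE, S, T, hS, hT, hTS, h1, h2, h3⟩ := ih (by omega)
      let F : E →ₗ[𝕜] (S → 𝕜) :=
        { toFun := fun x t => U x t
          map_add' := by intro x y; ext t; simp
          map_smul' := by intro x y; ext t; simp }
      have hker : LinearMap.ker F ≠ ⊥ := by
        apply LinearMap.ker_ne_bot_of_finrank_lt
        rw [hE, Module.finrank_fintype_fun_eq_card, Fintype.card_coe]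
        have : j * M ≤ k * M := Nat.mul_le_mul_right _ (by omega)
        omega
      obtain ⟨x0, hx0k, hx0⟩ := Submodule.exists_mem_ne_zero_of_ne_bot hker
      have hx0S : ∀ t ∈ S, U (x0 : X) t = 0 := by
        intro t ht
        exact congrFun (LinearMap.mem_ker.mp hx0k) ⟨t, ht⟩
      have hx0' : (x0 : X) ≠ 0 := by simpa using hx0
      have hUpos : 0 < ‖U (x0 : X)‖ :=
        lt_of_lt_of_le (mul_pos hε (norm_pos_iff.mpr hx0')) (hlow _ x0.2)
      set x : X := ((‖U (x0 : X)‖⁻¹ : ℝ) : 𝕜) • (x0 : X) with hx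
      have hxE : x ∈ E := E.smul_mem _ x0.2
      have hUx : ‖U x‖ = 1 := by
        rw [hx, map_smul, norm_smul, RCLike.norm_ofReal, abs_of_pos (by positivity)]
        field_simp
      have hxS : ∀ t ∈ S, U x t = 0 := by
        intro t ht
        rw [hx, map_smul, ZeroAtInftyContinuousMap.smul_apply, hx0S t ht, smul_zero]
      have hxn : ‖x‖ ≤ 1 / ε := by
        rw [le_div_iff₀ hε, mul_comm, ← hUx]
        exact hlow x hxE
      have hx1 : ∀ t, ‖U x t‖ ≤ 1 := fun t => hUx ▸ c0_apply_le _ t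
      obtain ⟨t0, ht0⟩ : ∃ t0, 1 / 2 ≤ ‖U x t0‖ := by
        by_contra hc
        push Not at hc
        have := c0_norm_le (U x) (C := 1 / 2) (by norm_num) fun t => (hc t).le
        rw [hUx] at this
        norm_num at this
      have ht0S : t0 ∉ S := by
        intro h
        rw [hxS t0 h, norm_zero] at ht0
        norm_num at ht0
      have hfin : {t | η ≤ ‖U x t‖}.Finite := by
        by_contra hinf
        obtain ⟨A, hA, hAc⟩ := Set.Infinite.exists_subset_card_eq hinf (M + 1)
        have := hM x hxn A (fun t ht => hA ht)
        omega
      have hBc : hfin.toFinset.card ≤ M := hM x hxn _ (fun t ht => by simpa using ht)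
      refine ⟨y + x, E.add_mem hyE hxE, S ∪ hfin.toFinset, insert t0 T, ?_, ?_, ?_, ?_, ?_, ?_⟩
      · have := Finset.card_union_le S hfin.toFinset
        rw [Nat.succ_mul]
        omega
      · rw [Finset.card_insert_of_notMem (fun h => ht0S (hTS h)), hT]
      · intro t ht
        rw [Finset.mem_insert] at ht
        rw [Finset.mem_union]
        rcases ht with rfl | ht
        · right
          simp only [Set.Finite.mem_toFinset, Set.mem_ofPred_eq]
          linarith
        · exact Or.inl (hTS ht)
      · intro t ht
        simp only [Finset.mem_union, Set.Finite.mem_toFinset, Set.mem_ofPred_eq, not_or, not_le] at ht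
        rw [map_add, ZeroAtInftyContinuousMap.add_apply]
        have := norm_add_le (U y t) (U x t)
        have := h1 t ht.1
        push_cast
        linarith [ht.2]
      · intro t
        rw [map_add, ZeroAtInftyContinuousMap.add_apply]
        push_cast
        by_cases ht : t ∈ S
        · rw [hxS t ht, add_zero]
          linarith [h2 t]
        · have := norm_add_le (U y t) (U x t)
          linarith [h1 t ht, hx1 t]
      · intro t ht
        rw [map_add, ZeroAtInftyContinuousMap.add_apply]
        push_cast
        rw [Finset.mem_insert] at ht
        rcases ht with rfl | ht
        · have := norm_sub_le (U y t + U x t) (U y t)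
          rw [add_sub_cancel_left] at this
          linarith [h1 t ht0S]
        · rw [hxS t (hTS ht), add_zero]
          linarith [h3 t ht]
  obtain ⟨y, hyE, S, T, hS, hT, hTS, h1, h2, h3⟩ := claim k le_rfl
  rw [hkη] at h2 h3
  have hUy : ‖U y‖ ≤ 2 := c0_norm_le _ (by norm_num) fun t => by linarith [h2 t]
  have hyn : ‖y‖ ≤ 2 / ε := by
    rw [le_div_iff₀ hε, mul_comm]
    exact (hlow y hyE).trans hUy
  have := hM₀ y hyn T (fun t ht => by linarith [h3 t ht])
  omega

lemma sscs_triv {X Y : Type*} [NormedAddCommGroup X] [NormedSpace 𝕜 X] [NormedAddCommGroup Y]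
    [NormedSpace 𝕜 Y] (hX : ¬ FiniteDimensional 𝕜 X) (U : X →L[𝕜] Y) : SupStrictCosing U := by
  intro ε hε
  refine ⟨1, fun n hn E _ hfr => ?_⟩
  have : FiniteDimensional 𝕜 (Y ⧸ E) := Module.finite_of_finrank_pos (by omega)
  have hker : LinearMap.ker (E.mkQ.comp U.toLinearMap) ≠ ⊥ := by
    intro h
    exact hX (FiniteDimensional.of_injective _ (LinearMap.ker_eq_bot.mp h))
  obtain ⟨x, hxk, hx⟩ := Submodule.exists_mem_ne_zero_of_ne_bot hker
  have hxE : U x ∈ E := by simpa using hxk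
  refine ⟨((‖x‖⁻¹ : ℝ) : 𝕜) • x, ?_, ?_⟩
  · rw [norm_smul, RCLike.norm_ofReal, abs_of_nonneg (by positivity)]
    have := norm_pos_iff.mpr hx
    field_simp
  · rw [map_smul, Metric.infDist_zero_of_mem (E.smul_mem _ hxE)]
    exact hε

lemma exists_coord_functional {Y : Type*} [NormedAddCommGroup Y] [NormedSpace 𝕜 Y]
    (J : ZeroAtInftyContinuousMap ℕ 𝕜 →L[𝕜] Y) (c : ℝ) (hc : 0 < c)
    (hJ : ∀ z, c * ‖z‖ ≤ ‖J z‖) (t : ℕ) :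
    ∃ g : Y →L[𝕜] 𝕜, (∀ z, g (J z) = z t) ∧ ‖g‖ ≤ 1 / c := by
  have hinj : Function.Injective J.toLinearMap := by
    rw [← LinearMap.ker_eq_bot, LinearMap.ker_eq_bot']
    intro z hz
    have hz' : J z = 0 := hz
    have := hJ z
    rw [hz', norm_zero] at this
    have h0 := norm_nonneg z
    exact norm_eq_zero.mp (by nlinarith)
  let e := LinearEquiv.ofInjective J.toLinearMap hinj
  let ev : ZeroAtInftyContinuousMap ℕ 𝕜 →ₗ[𝕜] 𝕜 :=
    { toFun := fun z => z t
      map_add' := by intros; rfl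
      map_smul' := by intros; rfl }
  let f : (LinearMap.range J.toLinearMap) →L[𝕜] 𝕜 :=
    (ev.comp e.symm.toLinearMap).mkContinuous (1 / c) (by
      intro y
      obtain ⟨z, rfl⟩ := e.surjective y
      simp only [LinearMap.comp_apply, LinearEquiv.coe_coe, LinearEquiv.symm_apply_apply]
      have h1 : ‖ev z‖ ≤ ‖z‖ := c0_apply_le z t
      have h2 : c * ‖z‖ ≤ ‖e z‖ := hJ z
      rw [div_mul_eq_mul_div, one_mul, le_div_iff₀ hc]
      nlinarith)
  obtain ⟨g, hg, hgn⟩ := exists_extension_norm_eq (LinearMap.range J.toLinearMap) f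
  refine ⟨g, fun z => ?_, ?_⟩
  · have := hg (e z)
    have h2 : f (e z) = z t := by
      change ev (e.symm (e z)) = z t
      rw [LinearEquiv.symm_apply_apply]
      rfl
    rw [h2] at this
    exact this
  · rw [hgn]
    exact LinearMap.mkContinuous_norm_le _ (by positivity) _

end

/-- The index set: the disjoint union of the discrete cubes. -/
abbrev Om : Type := Σ k : ℕ, (Fin k → Bool)

/-- `2^(k/p)`. -/
def rho (p : ℝ) (k : ℕ) : ℝ := ((2 : ℝ) ^ k) ^ (1 / p)

lemma rho_pos (p : ℝ) (k : ℕ) : 0 < rho p k := by unfold rho; positivity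

lemma rho_rpow {p : ℝ} (hp : 0 < p) (k : ℕ) : rho p k ^ p = 2 ^ k := by
  unfold rho
  rw [← Real.rpow_mul (by positivity), one_div, inv_mul_cancel₀ hp.ne', Real.rpow_one]

section
variable {𝕜 : Type*} [RCLike 𝕜]

/-- Block diagonal normalised Walsh transform. -/
def Wop (p : ℝ) (x : Om → 𝕜) (t : Om) : 𝕜 :=
  ((rho p t.1 / 2 ^ t.1 : ℝ) : 𝕜) * ∑ b, ((walsh t.1 t.2 b : ℝ) : 𝕜) * x ⟨t.1, b⟩

lemma sum_block_le {f : Om → ℝ} {S : ℝ} (h : ∀ F : Finset Om, ∑ s ∈ F, f s ≤ S) (k : ℕ) :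
    ∑ b, f ⟨k, b⟩ ≤ S := by
  have := h (Finset.univ.map (Function.Embedding.sigmaMk (β := fun k : ℕ => (Fin k → Bool)) k))
  rwa [Finset.sum_map] at this

lemma Wop_norm_le (p : ℝ) (x : Om → 𝕜) (t : Om) :
    ‖Wop p x t‖ ≤ (rho p t.1 / 2 ^ t.1) * ∑ b, ‖x ⟨t.1, b⟩‖ := by
  have h0 : 0 < rho p t.1 / 2 ^ t.1 := by have := rho_pos p t.1; positivity
  unfold Wop
  rw [norm_mul, RCLike.norm_ofReal, abs_of_pos h0]
  gcongr
  refine (norm_sum_le _ _).trans (Finset.sum_le_sum fun b _ => ?_)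
  rw [norm_mul, walsh_norm, one_mul]

lemma Wop_bound {p : ℝ} (hp1 : 1 < p) (x : Om → 𝕜) {C : ℝ} (hC : 0 ≤ C)
    (hx : ∀ F : Finset Om, ∑ s ∈ F, ‖x s‖ ^ p ≤ C ^ p) (t : Om) : ‖Wop p x t‖ ≤ C := by
  refine (Wop_norm_le p x t).trans ?_
  have hp0 : 0 < p := by linarith
  have hr := rho_pos p t.1
  have h0 : 0 < rho p t.1 / 2 ^ t.1 := by positivity
  rw [← Real.rpow_le_rpow_iff (by positivity) hC hp0]
  have h1 := Real.rpow_sum_le_const_mul_sum_rpow (s := Finset.univ)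
    (f := fun b => ‖x ⟨t.1, b⟩‖) hp1.le
  simp only [abs_norm] at h1
  have h2 := sum_block_le hx t.1
  rw [Real.mul_rpow h0.le (by positivity), Real.div_rpow hr.le (by positivity), rho_rpow hp0]
  have hcard : ((Finset.univ : Finset (Fin t.1 → Bool)).card : ℝ) = 2 ^ t.1 := by simp
  rw [hcard] at h1
  set n : ℝ := 2 ^ t.1 with hn
  have hnpos : 0 < n := by positivity
  calc n / n ^ p * (∑ b, ‖x ⟨t.1, b⟩‖) ^ p
      ≤ n / n ^ p * (n ^ (p - 1) * ∑ b, ‖x ⟨t.1, b⟩‖ ^ p) := by gcongr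
    _ = ∑ b, ‖x ⟨t.1, b⟩‖ ^ p := by
        rw [Real.rpow_sub hnpos, Real.rpow_one]
        have : 0 < n ^ p := by positivity
        field_simp
    _ ≤ C ^ p := h2

lemma Wop_count {p : ℝ} (hp1 : 1 < p) (hp2 : p < 2) (S η : ℝ) (hS : 0 < S) (hη : 0 < η) :
    ∃ M : ℕ, ∀ x : Om → 𝕜, (∀ F : Finset Om, ∑ s ∈ F, ‖x s‖ ^ p ≤ S) →
      ∀ A : Finset Om, (∀ t ∈ A, η ≤ ‖Wop p x t‖) → A.card ≤ M := by
  classical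
  have hp0 : 0 < p := by linarith
  set L : ℝ := (η / (2 * S)) ^ (1 / (1 - p)) with hL
  have hLpos : 0 < L := by positivity
  have hL1 : L ^ (1 - p) = η / (2 * S) := by
    rw [hL, ← Real.rpow_mul (by positivity), one_div, inv_mul_cancel₀ (by linarith), Real.rpow_one]
  refine ⟨⌈4 / η ^ 2 * (L ^ (2 - p) * S)⌉₊, fun x hx A hA => ?_⟩
  let xs : Om → 𝕜 := fun t => if ‖x t‖ ≤ L / rho p t.1 then x t else 0
  let xb : Om → 𝕜 := fun t => if ‖x t‖ ≤ L / rho p t.1 then 0 else x t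
  have hsplit : ∀ t, Wop p x t = Wop p xs t + Wop p xb t := by
    intro t
    unfold Wop
    rw [← mul_add, ← Finset.sum_add_distrib]
    congr 1
    apply Finset.sum_congr rfl
    intro b _
    rw [← mul_add]
    congr 1
    simp only [xs, xb]
    split_ifs <;> simp
  have hbig : ∀ t, ‖Wop p xb t‖ ≤ η / 2 := by
    intro t
    refine (Wop_norm_le p xb t).trans ?_
    have hr := rho_pos p t.1
    have hterm : ∀ b, ‖xb ⟨t.1, b⟩‖ ≤ (L / rho p t.1) ^ (1 - p) * ‖x ⟨t.1, b⟩‖ ^ p := by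
      intro b
      simp only [xb]
      split_ifs with h
      · rw [norm_zero]; positivity
      · push Not at h
        have hx0 : 0 < ‖x ⟨t.1, b⟩‖ := lt_trans (by positivity) h
        calc ‖x ⟨t.1, b⟩‖ = ‖x ⟨t.1, b⟩‖ ^ (1 - p) * ‖x ⟨t.1, b⟩‖ ^ p := by
              rw [← Real.rpow_add hx0]; simp
          _ ≤ _ := by
              gcongr ?_ * _
              exact Real.rpow_le_rpow_of_nonpos (by positivity) h.le (by linarith)
    have h2 := sum_block_le hx t.1
    calc rho p t.1 / 2 ^ t.1 * ∑ b, ‖xb ⟨t.1, b⟩‖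
        ≤ rho p t.1 / 2 ^ t.1 * ∑ b, (L / rho p t.1) ^ (1 - p) * ‖x ⟨t.1, b⟩‖ ^ p := by
          gcongr with b _
          exact hterm b
      _ = rho p t.1 / 2 ^ t.1 * ((L / rho p t.1) ^ (1 - p) * ∑ b, ‖x ⟨t.1, b⟩‖ ^ p) := by
          rw [← Finset.mul_sum]
      _ ≤ rho p t.1 / 2 ^ t.1 * ((L / rho p t.1) ^ (1 - p) * S) := by gcongr
      _ = η / 2 := by
          rw [Real.div_rpow hLpos.le hr.le, hL1, Real.rpow_sub hr, Real.rpow_one, rho_rpow hp0]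
          field_simp
  have hsmall : ∀ t ∈ A, η ^ 2 / 4 ≤ ‖Wop p xs t‖ ^ 2 := by
    intro t ht
    have h1 := hA t ht
    have h2 := hbig t
    rw [hsplit t] at h1
    have h3 := norm_add_le (Wop p xs t) (Wop p xb t)
    have h4 : η / 2 ≤ ‖Wop p xs t‖ := by linarith
    nlinarith
  have hblock : ∀ k, ∑ a, ‖Wop p xs ⟨k, a⟩‖ ^ 2 ≤ L ^ (2 - p) * ∑ b, ‖x ⟨k, b⟩‖ ^ p := by
    intro k
    have hr := rho_pos p k
    have h0 : 0 < rho p k / 2 ^ k := by positivity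
    have hterm : ∀ b, ‖xs ⟨k, b⟩‖ ^ 2 ≤ (L / rho p k) ^ (2 - p) * ‖x ⟨k, b⟩‖ ^ p := by
      intro b
      simp only [xs]
      split_ifs with h
      · rcases (norm_nonneg (x ⟨k, b⟩)).eq_or_lt with hx0 | hx0
        · rw [← hx0]
          rw [Real.zero_rpow hp0.ne']
          simp
        · calc ‖x ⟨k, b⟩‖ ^ 2 = ‖x ⟨k, b⟩‖ ^ (2 - p) * ‖x ⟨k, b⟩‖ ^ p := by
                rw [← Real.rpow_add hx0]; simp
            _ ≤ _ := by
                gcongr ?_ * _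
                exact Real.rpow_le_rpow hx0.le h (by linarith)
      · rw [norm_zero]
        have : 0 ≤ (L / rho p k) ^ (2 - p) * ‖x ⟨k, b⟩‖ ^ p := by positivity
        simpa using this
    have hpar := walsh_parseval (𝕜 := 𝕜) (H := 𝕜) k (fun b => xs ⟨k, b⟩)
    simp only [smul_eq_mul] at hpar
    calc ∑ a, ‖Wop p xs ⟨k, a⟩‖ ^ 2
        = (rho p k / 2 ^ k) ^ 2 * (2 ^ k * ∑ b, ‖xs ⟨k, b⟩‖ ^ 2) := by
          rw [← hpar, Finset.mul_sum]
          apply Finset.sum_congr rfl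
          intro a _
          unfold Wop
          rw [norm_mul, RCLike.norm_ofReal, abs_of_pos h0, mul_pow]
      _ ≤ (rho p k / 2 ^ k) ^ 2 * (2 ^ k * ∑ b, (L / rho p k) ^ (2 - p) * ‖x ⟨k, b⟩‖ ^ p) := by
          gcongr with b _
          exact hterm b
      _ = L ^ (2 - p) * ∑ b, ‖x ⟨k, b⟩‖ ^ p := by
          rw [← Finset.mul_sum, Real.div_rpow hLpos.le hr.le, Real.rpow_sub hr, rho_rpow hp0,
            Real.rpow_two]
          field_simp
  have hAsub : A ⊆ (A.image Sigma.fst).sigma (fun _ => Finset.univ) := by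
    intro t ht
    rw [Finset.mem_sigma]
    exact ⟨Finset.mem_image_of_mem _ ht, Finset.mem_univ _⟩
  have htot : (A.card : ℝ) * (η ^ 2 / 4) ≤ L ^ (2 - p) * S := by
    calc (A.card : ℝ) * (η ^ 2 / 4) = ∑ t ∈ A, η ^ 2 / 4 := by simp
      _ ≤ ∑ t ∈ A, ‖Wop p xs t‖ ^ 2 := Finset.sum_le_sum hsmall
      _ ≤ ∑ t ∈ (A.image Sigma.fst).sigma (fun _ => Finset.univ), ‖Wop p xs t‖ ^ 2 :=
          Finset.sum_le_sum_of_subset_of_nonneg hAsub (fun _ _ _ => by positivity)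
      _ = ∑ k ∈ A.image Sigma.fst, ∑ a, ‖Wop p xs ⟨k, a⟩‖ ^ 2 := Finset.sum_sigma _ _ _
      _ ≤ ∑ k ∈ A.image Sigma.fst, L ^ (2 - p) * ∑ b, ‖x ⟨k, b⟩‖ ^ p :=
          Finset.sum_le_sum fun k _ => hblock k
      _ = L ^ (2 - p) * ∑ t ∈ (A.image Sigma.fst).sigma (fun _ => Finset.univ), ‖x t‖ ^ p := by
          rw [← Finset.mul_sum, Finset.sum_sigma]
      _ ≤ L ^ (2 - p) * S := by gcongr; exact hx _
  have : (A.card : ℝ) ≤ 4 / η ^ 2 * (L ^ (2 - p) * S) := by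
    calc (A.card : ℝ) = 4 / η ^ 2 * (A.card * (η ^ 2 / 4)) := by field_simp
      _ ≤ _ := by gcongr
  exact_mod_cast this.trans (Nat.le_ceil _)

lemma exists_U (p : ℝ) (hp1 : 1 < p) (hp2 : p < 2) [Fact (1 ≤ ENNReal.ofReal p)] (e : ℕ ≃ Om) :
    ∃ U : lp (fun _ : ℕ => 𝕜) (ENNReal.ofReal p) →L[𝕜] ZeroAtInftyContinuousMap ℕ 𝕜,
      FinStrictSing U ∧ ∀ x t, U x t = Wop p (fun s => x (e.symm s)) (e t) := by
  classical
  have hp0 : 0 < p := by linarith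
  have hpr : (ENNReal.ofReal p).toReal = p := ENNReal.toReal_ofReal hp0.le
  have hsum : ∀ (x : lp (fun _ : ℕ => 𝕜) (ENNReal.ofReal p)) (F : Finset Om),
      ∑ s ∈ F, ‖x (e.symm s)‖ ^ p ≤ ‖x‖ ^ p := by
    intro x F
    have := lp.sum_rpow_le_norm_rpow (by rw [hpr]; exact hp0) x (F.map e.symm.toEmbedding)
    rw [hpr, Finset.sum_map] at this
    exact this
  have hcount : ∀ R η : ℝ, 0 < R → 0 < η → ∃ M : ℕ,
      ∀ x : lp (fun _ : ℕ => 𝕜) (ENNReal.ofReal p), ‖x‖ ≤ R → ∀ A : Finset ℕ,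
        (∀ t ∈ A, η ≤ ‖Wop p (fun s => x (e.symm s)) (e t)‖) → A.card ≤ M := by
    intro R η hR hη
    obtain ⟨M, hM⟩ := Wop_count (𝕜 := 𝕜) hp1 hp2 (R ^ p) η (by positivity) hη
    refine ⟨M, fun x hx A hA => ?_⟩
    have := hM (fun s => x (e.symm s))
      (fun F => (hsum x F).trans (Real.rpow_le_rpow (norm_nonneg _) hx hp0.le))
      (A.map e.toEmbedding) (by
        intro t ht
        rw [Finset.mem_map] at ht
        obtain ⟨a, ha, rfl⟩ := ht
        exact hA a ha)
    rwa [Finset.card_map] at this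
  let U0 : lp (fun _ : ℕ => 𝕜) (ENNReal.ofReal p) →ₗ[𝕜] ZeroAtInftyContinuousMap ℕ 𝕜 :=
    { toFun := fun x =>
        { toFun := fun t => Wop p (fun s => x (e.symm s)) (e t)
          continuous_toFun := continuous_of_discreteTopology
          zero_at_infty' := by
            rw [Filter.cocompact_eq_cofinite, Metric.tendsto_nhds]
            intro ε hε
            rw [Filter.eventually_cofinite]
            obtain ⟨M, hM⟩ := hcount (‖x‖ + 1) ε (by positivity) hε
            by_contra hinf
            obtain ⟨A, hA, hAc⟩ := Set.Infinite.exists_subset_card_eq hinf (M + 1)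
            have := hM x (by linarith) A (fun t ht => by
              have := hA ht
              simpa using this)
            omega }
      map_add' := by
        intro x y
        ext t
        change Wop p (fun s => (x + y) (e.symm s)) (e t) =
          Wop p (fun s => x (e.symm s)) (e t) + Wop p (fun s => y (e.symm s)) (e t)
        unfold Wop
        rw [← mul_add, ← Finset.sum_add_distrib]
        simp [mul_add]
      map_smul' := by
        intro r x
        ext t
        change Wop p (fun s => (r • x) (e.symm s)) (e t) =
          r • Wop p (fun s => x (e.symm s)) (e t)
        unfold Wop
        rw [smul_eq_mul, mul_left_comm]
        congr 1
        rw [Finset.mul_sum]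
        apply Finset.sum_congr rfl
        intro b _
        simp [mul_left_comm] }
  have hU0 : ∀ x t, U0 x t = Wop p (fun s => x (e.symm s)) (e t) := fun x t => rfl
  let U := U0.mkContinuous 1 (by
    intro x
    rw [one_mul]
    refine c0_norm_le _ (norm_nonneg _) fun t => ?_
    rw [hU0]
    exact Wop_bound hp1 _ (norm_nonneg _) (hsum x) _)
  have hU : ∀ x t, U x t = Wop p (fun s => x (e.symm s)) (e t) := hU0
  refine ⟨U, fss_of_count U ?_, hU⟩
  intro R η hR hη
  obtain ⟨M, hM⟩ := hcount R η hR hη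
  refine ⟨M, fun x hx A hA => hM x hx A fun t ht => ?_⟩
  rw [← hU]
  exact hA t ht

lemma lp_not_fd (q : ℝ≥0∞) [Fact (1 ≤ q)] : ¬ FiniteDimensional 𝕜 (lp (fun _ : ℕ => 𝕜) q) := by
  classical
  intro h
  have hli : LinearIndependent 𝕜 (fun i : ℕ => (lp.single q i (1 : 𝕜) : lp (fun _ : ℕ => 𝕜) q)) := by
    rw [linearIndependent_iff']
    intro s g hg i hi
    have h1 := congrArg (fun f : lp (fun _ : ℕ => 𝕜) q => f i) hg
    simp only [lp.coeFn_sum, Finset.sum_apply, lp.coeFn_smul, Pi.smul_apply, lp.coeFn_zero,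
      Pi.zero_apply] at h1
    rw [Finset.sum_eq_single i] at h1
    · simpa using h1
    · intro b _ hb
      rw [lp.single_apply_ne _ _ _ (Ne.symm hb), smul_zero]
    · intro h; exact absurd hi h
  have := hli.finite
  exact not_finite ℕ

end

section
variable {𝕜 : Type*} [RCLike 𝕜]

lemma walsh_hilbert_bound {H : Type*} [NormedAddCommGroup H] [InnerProductSpace 𝕜 H] (k : ℕ)
    (v : (Fin k → Bool) → H) (g : (Fin k → Bool) → (H →L[𝕜] 𝕜)) (C D : ℝ) (hC : 0 ≤ C)
    (hD : 0 ≤ D) (hv : ∀ b, ‖v b‖ ≤ C) (hg : ∀ a, ‖g a‖ ≤ D) :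
    ‖∑ a, g a (∑ b, ((walsh k a b : ℝ) : 𝕜) • v b)‖ ≤ D * C * (2 ^ k * Real.sqrt (2 ^ k)) := by
  set n : ℝ := 2 ^ k with hn
  have hn0 : 0 < n := by positivity
  set s : (Fin k → Bool) → ℝ := fun a => ‖∑ b, ((walsh k a b : ℝ) : 𝕜) • v b‖ with hs
  have hcard : ((Finset.univ : Finset (Fin k → Bool)).card : ℝ) = n := by simp [hn]
  have h1 : (∑ a, s a) ^ 2 ≤ n * ∑ a, s a ^ 2 := by
    rw [← hcard]
    exact sq_sum_le_card_mul_sum_sq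
  have h2 : ∑ a, s a ^ 2 = n * ∑ b, ‖v b‖ ^ 2 := walsh_parseval k v
  have h3 : ∑ b, ‖v b‖ ^ 2 ≤ n * C ^ 2 := by
    calc ∑ b, ‖v b‖ ^ 2 ≤ ∑ b : Fin k → Bool, C ^ 2 := by
          gcongr with b _
          exact hv b
      _ = n * C ^ 2 := by rw [Finset.sum_const, nsmul_eq_mul, hcard]
  have h4 : ∑ a, s a ≤ C * (n * Real.sqrt n) := by
    apply le_of_sq_le_sq _ (by positivity)
    calc (∑ a, s a) ^ 2 ≤ n * (n * (n * C ^ 2)) := by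
          refine h1.trans ?_
          rw [h2]
          gcongr
      _ = (C * (n * Real.sqrt n)) ^ 2 := by
          rw [mul_pow, mul_pow, Real.sq_sqrt hn0.le]; ring
  calc ‖∑ a, g a (∑ b, ((walsh k a b : ℝ) : 𝕜) • v b)‖
      ≤ ∑ a, D * s a := by
        refine (norm_sum_le _ _).trans (Finset.sum_le_sum fun a _ => ?_)
        exact ((g a).le_opNorm _).trans (by gcongr; exact hg a)
    _ = D * ∑ a, s a := by rw [Finset.mul_sum]
    _ ≤ D * (C * (n * Real.sqrt n)) := by gcongr
    _ = _ := by ring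

end

theorem statement8 (𝕜 : Type*) [RCLike 𝕜] (p : ℝ) (hp1 : 1 < p) (hp2 : p < 2)
    [Fact (1 ≤ ENNReal.ofReal p)]
    (X : Type*) [NormedAddCommGroup X] [NormedSpace 𝕜 X] [CompleteSpace X]
    (Y : Type*) [NormedAddCommGroup Y] [NormedSpace 𝕜 Y] [CompleteSpace Y]
    (P : X →L[𝕜] lp (fun _ : ℕ => 𝕜) (ENNReal.ofReal p))
    (Q : lp (fun _ : ℕ => 𝕜) (ENNReal.ofReal p) →L[𝕜] X)
    (hPQ : ∀ z, P (Q z) = z)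
    (J : ZeroAtInftyContinuousMap ℕ 𝕜 →L[𝕜] Y) (c : ℝ) (hc : 0 < c)
    (hJ : ∀ z, c * ‖z‖ ≤ ‖J z‖) :
    ∃ U : lp (fun _ : ℕ => 𝕜) (ENNReal.ofReal p) →L[𝕜] ZeroAtInftyContinuousMap ℕ 𝕜,
      FinStrictSing U ∧ SupStrictCosing U ∧
      J.comp (U.comp P) ∉ closedSpanHilbertFactorable 𝕜 X Y := by
  classical
  have hp0 : 0 < p := by linarith
  have hpr : (ENNReal.ofReal p).toReal = p := ENNReal.toReal_ofReal hp0.le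
  have hInf : Infinite Om :=
    Infinite.of_injective (fun k : ℕ => (⟨k, fun _ => false⟩ : Om)) (fun a b h => by
      exact congrArg Sigma.fst h)
  obtain ⟨e⟩ : Nonempty (ℕ ≃ Om) := nonempty_equiv_of_countable
  obtain ⟨U, hfss, hU⟩ := exists_U (𝕜 := 𝕜) p hp1 hp2 e
  refine ⟨U, hfss, sscs_triv (lp_not_fd _) U, ?_⟩
  intro hmem
  choose g hgJ hgn using fun t => exists_coord_functional J c hc hJ t
  -- test vectors
  let w : ∀ k : ℕ, (Fin k → Bool) → lp (fun _ : ℕ => 𝕜) (ENNReal.ofReal p) := fun k a =>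
    ∑ b, ((walsh k a b : ℝ) : 𝕜) • lp.single (ENNReal.ofReal p) (e.symm ⟨k, b⟩) (1 : 𝕜)
  have hval : ∀ k a b, (w k a) (e.symm ⟨k, b⟩) = ((walsh k a b : ℝ) : 𝕜) := by
    intro k a b
    simp only [w, lp.coeFn_sum, Finset.sum_apply, lp.coeFn_smul, Pi.smul_apply]
    rw [Finset.sum_eq_single b]
    · simp
    · intro b' _ hb'
      rw [lp.single_apply_ne _ _ _ (by simpa using Ne.symm hb'), smul_zero]
    · simp
  have hwn : ∀ k a, ‖w k a‖ = rho p k := by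
    intro k a
    have h1 := lp.norm_sum_single (E := fun _ : ℕ => 𝕜) (p := ENNReal.ofReal p)
      (by rw [hpr]; exact hp0)
      (fun i => (w k a) i)
      (Finset.univ.map ((Function.Embedding.sigmaMk (β := fun k : ℕ => (Fin k → Bool)) k).trans
        e.symm.toEmbedding))
    rw [Finset.sum_map, Finset.sum_map, hpr] at h1
    have h2 : w k a = ∑ b, lp.single (ENNReal.ofReal p) (e.symm ⟨k, b⟩)
        ((walsh k a b : ℝ) : 𝕜) := by
      apply Finset.sum_congr rfl
      intro b _
      rw [← lp.single_smul, smul_eq_mul, mul_one]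
    have h3 : ‖w k a‖ ^ p = 2 ^ k := by
      rw [h2]
      have he : ∀ b, ((Function.Embedding.sigmaMk (β := fun k : ℕ => (Fin k → Bool)) k).trans
        e.symm.toEmbedding) b = e.symm ⟨k, b⟩ := fun b => rfl
      simp only [he, hval, walsh_norm, Real.one_rpow] at h1
      rw [h1]
      simp
    rw [← rho_rpow hp0 k] at h3
    exact Real.rpow_left_injOn hp0.ne' (norm_nonneg _) (rho_pos p k).le h3
  have hUw : ∀ k a, U (w k a) (e.symm ⟨k, a⟩) = ((rho p k : ℝ) : 𝕜) := by
    intro k a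
    rw [hU, Equiv.apply_symm_apply]
    unfold Wop
    simp only [hval]
    have : (∑ b, ((walsh k a b : ℝ) : 𝕜) * ((walsh k a b : ℝ) : 𝕜)) = ((2 ^ k : ℝ) : 𝕜) := by
      simp_rw [← RCLike.ofReal_mul, walsh_sq]
      push_cast
      simp
    rw [this, ← RCLike.ofReal_mul]
    congr 1
    field_simp
  let φ : ℕ → (X →L[𝕜] Y) → 𝕜 := fun k T => ∑ a, g (e.symm ⟨k, a⟩) (T (Q (w k a)))
  have hφadd : ∀ k S T, φ k (S + T) = φ k S + φ k T := by
    intro k S T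
    simp [φ, Finset.sum_add_distrib]
  have hφsmul : ∀ k (r : 𝕜) T, φ k (r • T) = r * φ k T := by
    intro k r T
    simp [φ, Finset.mul_sum]
  have hφbd : ∀ k T, ‖φ k T‖ ≤ 2 ^ k * (1 / c * (‖T‖ * (‖Q‖ * rho p k))) := by
    intro k T
    calc ‖φ k T‖ ≤ ∑ a : Fin k → Bool, 1 / c * (‖T‖ * (‖Q‖ * rho p k)) := by
          refine (norm_sum_le _ _).trans (Finset.sum_le_sum fun a _ => ?_)
          refine ((g _).le_opNorm _).trans ?_
          gcongr
          · exact hgn _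
          · refine (T.le_opNorm _).trans ?_
            gcongr
            rw [← hwn k a]
            exact Q.le_opNorm _
      _ = _ := by simp
  have hφU : ∀ k, φ k (J.comp (U.comp P)) = ((2 ^ k * rho p k : ℝ) : 𝕜) := by
    intro k
    simp only [φ, ContinuousLinearMap.comp_apply, hPQ, hgJ, hUw]
    push_cast
    simp
  have hspan : ∀ T ∈ Submodule.span 𝕜 {T : X →L[𝕜] Y | ∃ (A : X →L[𝕜] lp (fun _ : ℕ => 𝕜) 2)
      (B : lp (fun _ : ℕ => 𝕜) 2 →L[𝕜] Y), T = B.comp A},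
      ∃ K : ℝ, ∀ k, ‖φ k T‖ ≤ K * (2 ^ k * Real.sqrt (2 ^ k)) := by
    intro T hT
    induction hT using Submodule.span_induction with
    | mem T h =>
      obtain ⟨A, B, rfl⟩ := h
      refine ⟨(1 / c * ‖B‖) * (‖A‖ * ‖Q‖), fun k => ?_⟩
      have h1 : φ k (B.comp A) = ∑ a, ((g (e.symm ⟨k, a⟩)).comp B)
          (∑ b, ((walsh k a b : ℝ) : 𝕜) •
            A (Q (lp.single (ENNReal.ofReal p) (e.symm ⟨k, b⟩) (1 : 𝕜)))) := by
        simp only [φ, w, map_sum, map_smul, ContinuousLinearMap.comp_apply]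
      rw [h1]
      apply walsh_hilbert_bound k _ _ _ _ (by positivity) (by positivity)
      · intro b
        refine (A.le_opNorm _).trans ?_
        gcongr
        refine (Q.le_opNorm _).trans ?_
        rw [lp.norm_single (by simpa using hp0)]
        simp
      · intro a
        refine (ContinuousLinearMap.opNorm_comp_le _ _).trans ?_
        gcongr
        exact hgn _
    | zero =>
      refine ⟨0, fun k => ?_⟩
      simp [φ]
    | add S T _ _ hS hT =>
      obtain ⟨K, hK⟩ := hS
      obtain ⟨K', hK'⟩ := hT
      refine ⟨K + K', fun k => ?_⟩
      rw [hφadd, add_mul]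
      exact (norm_add_le _ _).trans (add_le_add (hK k) (hK' k))
    | smul r T _ hT =>
      obtain ⟨K, hK⟩ := hT
      refine ⟨‖r‖ * K, fun k => ?_⟩
      rw [hφsmul, norm_mul, mul_assoc]
      exact mul_le_mul_of_nonneg_left (hK k) (norm_nonneg _)
  have hcl : J.comp (U.comp P) ∈ closure ((Submodule.span 𝕜 {T : X →L[𝕜] Y |
      ∃ (A : X →L[𝕜] lp (fun _ : ℕ => 𝕜) 2) (B : lp (fun _ : ℕ => 𝕜) 2 →L[𝕜] Y),
        T = B.comp A} : Submodule 𝕜 (X →L[𝕜] Y)) : Set (X →L[𝕜] Y)) := hmem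
  have hδ : 0 < c / (2 * (‖Q‖ + 1)) := by positivity
  obtain ⟨T, hT, hTd⟩ := Metric.mem_closure_iff.mp hcl _ hδ
  obtain ⟨K, hK⟩ := hspan T hT
  rw [dist_eq_norm] at hTd
  set D := J.comp (U.comp P) - T with hD
  have hDQ : 1 / c * (‖D‖ * ‖Q‖) ≤ 1 / 2 := by
    have h1 : ‖D‖ * ‖Q‖ ≤ c / (2 * (‖Q‖ + 1)) * (‖Q‖ + 1) := by
      gcongr
      linarith
    have h2 : c / (2 * (‖Q‖ + 1)) * (‖Q‖ + 1) = c / 2 := by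
      field_simp
    rw [h2] at h1
    calc 1 / c * (‖D‖ * ‖Q‖) ≤ 1 / c * (c / 2) := by gcongr
      _ = 1 / 2 := by field_simp
  have hfinal : ∀ k : ℕ, ((2 : ℝ) ^ k) ^ (1 / p - 1 / 2) ≤ 2 * K := by
    intro k
    have hr := rho_pos p k
    have hsum : φ k (J.comp (U.comp P)) = φ k D + φ k T := by
      rw [← hφadd, hD, sub_add_cancel]
    have h1 : 2 ^ k * rho p k ≤ ‖φ k D‖ + ‖φ k T‖ := by
      have := norm_add_le (φ k D) (φ k T)
      rw [← hsum, hφU, RCLike.norm_ofReal, abs_of_pos (by positivity)] at this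
      exact this
    have h2 : ‖φ k D‖ ≤ 2 ^ k * rho p k * (1 / 2) := by
      calc ‖φ k D‖ ≤ 2 ^ k * (1 / c * (‖D‖ * (‖Q‖ * rho p k))) := hφbd k D
        _ = 2 ^ k * rho p k * (1 / c * (‖D‖ * ‖Q‖)) := by ring
        _ ≤ _ := by gcongr
    have h3 := hK k
    have hn : (0 : ℝ) < 2 ^ k := by positivity
    have h4 : rho p k ≤ 2 * K * Real.sqrt (2 ^ k) := by
      have : 2 ^ k * rho p k ≤ 2 ^ k * (2 * K * Real.sqrt (2 ^ k)) := by linarith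
      exact le_of_mul_le_mul_left this hn
    rw [Real.rpow_sub hn, ← Real.sqrt_eq_rpow, div_le_iff₀ (by positivity)]
    exact h4
  have hexp : 0 < 1 / p - 1 / 2 := by
    have := one_div_lt_one_div_of_lt hp0 hp2
    linarith
  have htend : Filter.Tendsto (fun k : ℕ => ((2 : ℝ) ^ k) ^ (1 / p - 1 / 2)) Filter.atTop
      Filter.atTop :=
    (tendsto_rpow_atTop hexp).comp (tendsto_pow_atTop_atTop_of_one_lt one_lt_two)
  obtain ⟨k, hk⟩ := (htend.eventually_gt_atTop (2 * K)).exists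
  exact absurd (hfinal k) (not_le.mpr hk)

end
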